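/- Let n be a positive even natural number and let t : ZMod n be the element (n/2 : ZMod n). A multiset m of positive natural numbers with m.sum = n is the full cycle type of the proliferating permutation under retrogradation with transposition n/2 of some series s : Fin n ≃ ZMod n with s 0 = 0 if and only if there exists a multiset μ of positive natural numbers with μ.sum = n/2 and m = μ + μ. In particular, the achievable cycle structures in this case coincide exactly with those achievable via retrograde inversion with n even and odd transposition. -/

import Mathlib

/-- The full cycle type of a permutation: the multiset of the sizes of all its orbits,
with fixed points counted as orbits of size 1. -/
def fullCycleType {α : Type*} [Fintype α] [DecidableEq α] (σ : Equiv.Perm α) : Multiset ℕ :=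
  σ.cycleType + Multiset.replicate (Finset.univ.filter fun x => σ x = x).card 1

/-- The proliferating permutation of a series `s` under retrogradation with transposition
`t`: `x ↦ s (rev (s.symm x)) + t`. -/
def ppR {n : ℕ} [NeZero n] (t : ZMod n) (s : Fin n ≃ ZMod n) : Equiv.Perm (ZMod n) :=
  (s.symm.trans (Fin.revPerm.trans s)).trans (Equiv.addRight t)

open Equiv.Perm in
theorem fullCycleType_permCongr {α β : Type*} [Fintype α] [DecidableEq α] [Fintype β]
    [DecidableEq β] (e : α ≃ β) (σ : Equiv.Perm α) :
    fullCycleType (e.permCongr σ) = fullCycleType σ := by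
  have hext : e.permCongr σ =
      σ.extendDomain (e.trans (Equiv.subtypeUnivEquiv (p := fun _ => True) fun _ => trivial).symm) := by
    ext x
    have := extendDomain_apply_image σ
      (e.trans (Equiv.subtypeUnivEquiv (p := fun _ => True) fun _ => trivial).symm) (e.symm x)
    simpa using this.symm
  have hfix : (Finset.univ.filter fun x => e.permCongr σ x = x).card =
      (Finset.univ.filter fun x => σ x = x).card := by
    refine Finset.card_equiv e.symm fun x => ?_
    rw [Finset.mem_filter_univ, Finset.mem_filter_univ, Equiv.permCongr_apply, Equiv.eq_symm_apply]
  unfold fullCycleType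
  rw [hfix, hext, cycleType_extendDomain]

open Equiv.Perm in
theorem fullCycleType_sumCongr {α β : Type*} [Fintype α] [DecidableEq α] [Fintype β]
    [DecidableEq β] (σ : Equiv.Perm α) (τ : Equiv.Perm β) :
    fullCycleType (Equiv.Perm.sumCongr σ τ) = fullCycleType σ + fullCycleType τ := by
  have hl : Equiv.Perm.sumCongr σ (1 : Equiv.Perm β) =
      σ.extendDomain (Equiv.ofInjective (Sum.inl : α → α ⊕ β) Sum.inl_injective) := by
    ext x
    rcases x with a | b
    · exact (extendDomain_apply_image σ (Equiv.ofInjective _ Sum.inl_injective) a).symm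
    · rw [extendDomain_apply_not_subtype _ _ (by simp)]
      simp
  have hr : Equiv.Perm.sumCongr (1 : Equiv.Perm α) τ =
      τ.extendDomain (Equiv.ofInjective (Sum.inr : β → α ⊕ β) Sum.inr_injective) := by
    ext x
    rcases x with a | b
    · rw [extendDomain_apply_not_subtype _ _ (by simp)]
      simp
    · exact (extendDomain_apply_image τ (Equiv.ofInjective _ Sum.inr_injective) b).symm
  have hdisj : Disjoint (Equiv.Perm.sumCongr σ (1 : Equiv.Perm β))
      (Equiv.Perm.sumCongr (1 : Equiv.Perm α) τ) := by
    rintro (a | b) <;> simp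
  have hcyc : (Equiv.Perm.sumCongr σ τ).cycleType = σ.cycleType + τ.cycleType := by
    rw [← mul_one σ, ← one_mul τ, ← sumCongr_mul, hdisj.cycleType_mul, hl, hr,
      cycleType_extendDomain, cycleType_extendDomain, mul_one, one_mul]
  have hfix : (Finset.univ.filter fun x => Equiv.Perm.sumCongr σ τ x = x).card =
      (Finset.univ.filter fun x => σ x = x).card + (Finset.univ.filter fun x => τ x = x).card := by
    rw [Finset.card_filter, Finset.card_filter, Finset.card_filter, Fintype.sum_sum_type]
    simp only [Equiv.Perm.sumCongr_apply, Sum.map_inl, Sum.map_inr, Sum.inl.injEq, Sum.inr.injEq]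
  unfold fullCycleType
  rw [hcyc, hfix, Multiset.replicate_add]
  abel

theorem fullCycleType_inv {α : Type*} [Fintype α] [DecidableEq α] (σ : Equiv.Perm α) :
    fullCycleType σ⁻¹ = fullCycleType σ := by
  rw [fullCycleType, fullCycleType, Equiv.Perm.cycleType_inv,
    Finset.filter_congr fun x _ => Equiv.Perm.inv_eq_iff_eq.trans eq_comm]

theorem sum_fullCycleType {α : Type*} [Fintype α] [DecidableEq α] (σ : Equiv.Perm α) :
    (fullCycleType σ).sum = Fintype.card α := by
  have h := Finset.card_filter_add_card_filter_not (s := (Finset.univ : Finset α)) (fun x => σ x = x)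
  simp only [fullCycleType, Multiset.sum_add, Equiv.Perm.sum_cycleType, Multiset.sum_replicate,
    smul_eq_mul, mul_one, Equiv.Perm.support, ← Finset.card_univ]
  rw [← h, add_comm]

theorem exists_fullCycleType_eq {α : Type*} [Fintype α] [DecidableEq α] (μ : Multiset ℕ)
    (hpos : ∀ c ∈ μ, 0 < c) (hsum : μ.sum = Fintype.card α) :
    ∃ σ : Equiv.Perm α, fullCycleType σ = μ := by
  have hsplit := Multiset.filter_add_not (fun c => 2 ≤ c) μ
  have hones : μ.filter (fun c => ¬ 2 ≤ c) =
      Multiset.replicate (Multiset.card (μ.filter fun c => ¬ 2 ≤ c)) 1 := by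
    refine Multiset.eq_replicate_card.2 fun c hc => ?_
    rw [Multiset.mem_filter] at hc
    have := hpos c hc.1
    omega
  have hs : (μ.filter fun c => 2 ≤ c).sum + Multiset.card (μ.filter fun c => ¬ 2 ≤ c) =
      Fintype.card α := by
    rw [← hsum]
    conv_rhs => rw [← hsplit, hones]
    simp
  obtain ⟨σ, hσ⟩ := (Equiv.Perm.exists_with_cycleType_iff α (m := μ.filter fun c => 2 ≤ c)).2
    ⟨by omega, fun a ha => (Multiset.mem_filter.1 ha).2⟩
  refine ⟨σ, ?_⟩
  have hsσ := sum_fullCycleType σ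
  simp only [fullCycleType, Multiset.sum_add, Multiset.sum_replicate, smul_eq_mul, mul_one,
    hσ] at hsσ
  rw [fullCycleType, hσ, show (Finset.univ.filter fun x => σ x = x).card =
    Multiset.card (μ.filter fun c => ¬ 2 ≤ c) by omega, ← hones, hsplit]

theorem Finset.even_card_of_involution {ι : Type*} (s : Finset ι) (g : ι → ι)
    (hne : ∀ a ∈ s, g a ≠ a) (hmem : ∀ a ∈ s, g a ∈ s) (hinv : ∀ a ∈ s, g (g a) = a) :
    Even s.card := by
  have h : ∑ _a ∈ s, (1 : ZMod 2) = 0 :=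
    Finset.sum_involution (fun a _ => g a) (fun _ _ => by decide) (fun a ha _ => hne a ha)
      hmem hinv
  rw [Finset.sum_const, nsmul_one] at h
  exact (ZMod.natCast_eq_zero_iff_even).1 h

section Involutions

variable {α : Type*} {A B : Equiv.Perm α}

theorem mul_zpow_involutive_apply (hA : ∀ x, A (A x) = x) (hB : ∀ x, B (B x) = x) (k : ℤ) (x : α) :
    A (((A * B) ^ k) x) = ((A * B) ^ (-k)) (A x) := by
  have hA' : A⁻¹ = A := by ext x; rw [Equiv.Perm.inv_eq_iff_eq, hA]
  have hB' : B⁻¹ = B := by ext x; rw [Equiv.Perm.inv_eq_iff_eq, hB]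
  have h : A * (A * B) * A⁻¹ = (A * B)⁻¹ := by
    rw [mul_inv_rev, hA', hB']
    ext x
    simp [hA]
  have h2 : A * (A * B) ^ k = (A * B) ^ (-k) * A := by
    rw [zpow_neg, ← inv_zpow, ← h, conj_zpow]
    group
  exact congrArg (fun f : Equiv.Perm α => f x) h2

theorem apply_ne_mul_zpow_apply (hA : ∀ x, A (A x) = x) (hB : ∀ x, B (B x) = x)
    (hA0 : ∀ x, A x ≠ x) (hB0 : ∀ x, B x ≠ x) (x : α) (k : ℤ) : ((A * B) ^ k) x ≠ A x := by
  intro h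
  rcases Int.even_or_odd' k with ⟨j, rfl | rfl⟩
  · apply hA0 (((A * B) ^ j) x)
    rw [mul_zpow_involutive_apply hA hB, ← h, ← Equiv.Perm.mul_apply, ← zpow_add]
    congr 2
    ring
  · apply hB0 (((A * B) ^ j) x)
    have hBA : ∀ y, B y = A ((A * B) y) := fun y => by simp [hA]
    rw [hBA, ← Equiv.Perm.mul_apply (A * B), ← zpow_one_add, mul_zpow_involutive_apply hA hB,
      ← h, ← Equiv.Perm.mul_apply, ← zpow_add]
    congr 2
    ring

variable [Fintype α] [DecidableEq α]

open Equiv.Perm in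
theorem inv_mem_cycleFactorsFinset_inv {σ c : Equiv.Perm α} (hc : c ∈ σ.cycleFactorsFinset) :
    c⁻¹ ∈ σ⁻¹.cycleFactorsFinset := by
  rw [mem_cycleFactorsFinset_iff] at hc ⊢
  refine ⟨hc.1.inv, fun a ha => ?_⟩
  have h := hc.2 (c⁻¹ a) (by
    rw [← support_inv c]
    exact apply_mem_support.2 ha)
  rw [← mul_apply, mul_inv_cancel, one_apply] at h
  rw [eq_comm, inv_eq_iff_eq]
  exact h

open Equiv.Perm in
theorem even_count_fullCycleType_mul (hA : ∀ x, A (A x) = x) (hB : ∀ x, B (B x) = x)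
    (hA0 : ∀ x, A x ≠ x) (hB0 : ∀ x, B x ≠ x) (k : ℕ) :
    Even ((fullCycleType (A * B)).count k) := by
  have hA' : A⁻¹ = A := by ext x; rw [inv_eq_iff_eq, hA]
  have hB' : B⁻¹ = B := by ext x; rw [inv_eq_iff_eq, hB]
  have hAA : A * A = 1 := by ext x; simp [hA]
  rw [fullCycleType, Multiset.count_add]
  refine Even.add ?_ ?_
  · rw [cycleType_def, Multiset.count_map, ← Finset.filter_val, Finset.card_val]
    refine Finset.even_card_of_involution _ (fun c => A * c⁻¹ * A⁻¹) ?_ ?_ ?_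
    · intro c hc heq
      rw [Finset.mem_filter] at hc
      have hcyc := (mem_cycleFactorsFinset_iff.1 hc.1).1
      obtain ⟨x, hx, -⟩ := id hcyc
      have hAx : c (A x) ≠ A x := by
        rw [← heq]
        simp only [mul_apply, hA', hA, ne_eq, EmbeddingLike.apply_eq_iff_eq]
        rw [inv_eq_iff_eq]
        exact fun h => hx h.symm
      obtain ⟨i, hi⟩ := hcyc.exists_zpow_eq hx hAx
      rw [cycle_is_cycleOf (mem_support.2 hx) hc.1, cycleOf_zpow_apply_self] at hi
      exact apply_ne_mul_zpow_apply hA hB hA0 hB0 x i hi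
    · intro c hc
      rw [Finset.mem_filter] at hc ⊢
      refine ⟨?_, ?_⟩
      · have := (mem_cycleFactorsFinset_conj _ A _).2 (inv_mem_cycleFactorsFinset_inv hc.1)
        convert this using 2
        rw [mul_inv_rev, hA', hB', mul_assoc, mul_assoc, hAA, mul_one]
      · simpa [card_support_conj] using hc.2
    · intro c _
      simp only [hA', mul_inv_rev, inv_inv]
      rw [show A * (A * (c * A)) * A = A * A * c * (A * A) by group, hAA, one_mul, mul_one]
  · rw [Multiset.count_replicate]
    split_ifs
    · refine Finset.even_card_of_involution _ A (fun x _ => hA0 x) ?_ (fun x _ => hA x)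
      intro x hx
      simp only [Finset.mem_filter, Finset.mem_univ, true_and, mul_apply] at hx ⊢
      have : B x = A x := by rw [← hx, hA, hx]
      rw [← this, hB, this]

    · exact Even.zero

end Involutions

theorem ppR_sub_apply_zero {n : ℕ} [NeZero n] (t : ZMod n) (s : Fin n ≃ ZMod n) :
    fullCycleType (ppR t (s.trans (Equiv.addRight (-s 0)))) = fullCycleType (ppR t s) := by
  rw [← fullCycleType_permCongr (Equiv.addRight (-s 0)) (ppR t s)]
  congr 1
  ext x
  simp [ppR]
  ring

theorem exists_finEquivSum_rev (N : ℕ) :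
    ∃ f : Fin (N + N) ≃ Fin N ⊕ Fin N, ∀ i, f i.rev = (f i).swap := by
  let g : Fin N ⊕ Fin N → Fin (N + N) :=
    Sum.elim (Fin.castAdd N) fun i => (Fin.castAdd N i).rev
  have hg : Function.Bijective g := by
    rw [Fintype.bijective_iff_injective_and_card]
    refine ⟨?_, by simp⟩
    rintro (a | a) (b | b) h <;> simp [g, Fin.ext_iff] at h ⊢ <;> omega
  have hswap : ∀ x, g x.swap = (g x).rev := by rintro (a | a) <;> simp [g]
  refine ⟨(Equiv.ofBijective g hg).symm, fun i => ?_⟩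
  rw [Equiv.symm_apply_eq, Equiv.ofBijective_apply, hswap]
  congr 1
  exact ((Equiv.ofBijective g hg).apply_symm_apply i).symm

theorem exists_sumEquivZMod_swap (N : ℕ) [NeZero (N + N)] :
    ∃ e : Fin N ⊕ Fin N ≃ ZMod (N + N), ∀ x, e x.swap = e x + (N : ZMod (N + N)) := by
  let g : Fin N ⊕ Fin N → ZMod (N + N) :=
    Sum.elim (fun i => ((i : ℕ) : ZMod (N + N))) fun i => ((i + N : ℕ) : ZMod (N + N))
  have hg : Function.Bijective g := by
    rw [Fintype.bijective_iff_injective_and_card]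
    refine ⟨?_, by simp [ZMod.card]⟩
    rintro (a | a) (b | b) h <;>
    · simp only [g, Sum.elim_inl, Sum.elim_inr, ZMod.natCast_eq_natCast_iff'] at h
      rw [Nat.mod_eq_of_lt (by omega), Nat.mod_eq_of_lt (by omega)] at h
      simp only [Sum.inl.injEq, Sum.inr.injEq, reduceCtorEq, Fin.ext_iff]
      omega
  refine ⟨Equiv.ofBijective g hg, ?_⟩
  have h2 : (N : ZMod (N + N)) + N = 0 := by
    rw [← Nat.cast_add, ZMod.natCast_self]
  rintro (a | a)
  · simp [g]
  · simp [g, add_assoc, h2]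

/-- for `n` even, a multiset `m` of positive naturals summing to `n` is the
full cycle type of the proliferating permutation under retrogradation with transposition
`n/2` of some series if and only if `m = μ + μ` for some multiset `μ` of positive
naturals with `μ.sum = n/2`. -/
theorem stmt_14 (n : ℕ) [NeZero n] (hn : Even n)
    (m : Multiset ℕ) (hm : ∀ c ∈ m, 0 < c) (hmsum : m.sum = n) :
    (∃ s : Fin n ≃ ZMod n, s 0 = 0 ∧
        fullCycleType (ppR ((n / 2 : ℕ) : ZMod n) s) = m) ↔
      (∃ μ : Multiset ℕ, (∀ c ∈ μ, 0 < c) ∧ μ.sum = n / 2 ∧ m = μ + μ) := by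
  obtain ⟨N, rfl⟩ := hn
  have hN : 0 < N := by
    have := NeZero.ne (N + N)
    omega
  rw [show (N + N) / 2 = N by omega]
  constructor
  · rintro ⟨s, -, hs⟩
    obtain ⟨μ, hμ⟩ : ∃ μ : Multiset ℕ, m = 2 • μ := by
      refine Multiset.exists_smul_of_dvd_count m fun c _ => ?_
      rw [← even_iff_two_dvd, ← hs]
      have h2 : (N : ZMod (N + N)) + N = 0 := by
        rw [← Nat.cast_add, ZMod.natCast_self]
      have h0 : (N : ZMod (N + N)) ≠ 0 := by
        rw [Ne, ZMod.natCast_eq_zero_iff]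
        exact fun h => absurd (Nat.le_of_dvd hN h) (by omega)
      refine even_count_fullCycleType_mul (A := Equiv.addRight (N : ZMod (N + N)))
        (B := s.symm.trans (Fin.revPerm.trans s)) ?_ ?_ ?_ ?_ c
      · intro x
        simp [add_assoc, h2]
      · intro x
        simp
      · intro x
        simpa using h0
      · intro x h
        rw [Equiv.trans_apply, Equiv.trans_apply, ← Equiv.eq_symm_apply] at h
        have := congrArg Fin.val h
        simp only [Fin.revPerm_apply, Fin.val_rev] at this
        omega
    rw [two_nsmul] at hμ
    subst hμ
    refine ⟨μ, fun c hc => hm c (Multiset.mem_add.2 (Or.inl hc)), ?_, rfl⟩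
    rw [Multiset.sum_add] at hmsum
    omega
  · rintro ⟨μ, hpos, hsum, rfl⟩
    obtain ⟨π, hπ⟩ := exists_fullCycleType_eq (α := Fin N) μ hpos (by simpa using hsum)
    obtain ⟨f, hf⟩ := exists_finEquivSum_rev N
    obtain ⟨e, he⟩ := exists_sumEquivZMod_swap N
    let s : Fin (N + N) ≃ ZMod (N + N) := (f.trans (Equiv.Perm.sumCongr 1 π)).trans e
    refine ⟨s.trans (Equiv.addRight (-s 0)), by simp, ?_⟩
    have hs : ppR (N : ZMod (N + N)) s = e.permCongr (Equiv.Perm.sumCongr π π⁻¹) := by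
      ext x
      obtain ⟨y, rfl⟩ := e.surjective x
      simp only [ppR, s, Equiv.trans_apply, Equiv.symm_trans_apply, Equiv.symm_apply_apply,
        Fin.revPerm_apply, hf, Equiv.apply_symm_apply, Equiv.coe_addRight, ← he,
        Equiv.permCongr_apply]
      rcases y with a | a <;> rfl
    rw [ppR_sub_apply_zero, hs, fullCycleType_permCongr, fullCycleType_sumCongr,
      fullCycleType_inv, hπ]
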